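/- arXiv:2303.06319 — 3 statements merged into one kernel-verified Lean document; each statement's English description precedes it below -/
import Mathlib

section
/- Fix R > 0, set ε = 2^R − 1, and fix a transmit SNR P > 0. Let X be a standard exponential random variable. Then for every integer n ≥ 1, the tail probability of the number of supported SNR levels is P(K(X) ≥ n) = exp(−ε(1+ε)^n/P). -/
open MeasureTheory ProbabilityTheory Real

/-- Partial sums of the preconfigured SNR levels: `η_n = (1+ε)^n - 1`. -/
noncomputable def eta (ε : ℝ) (n : ℕ) : ℝ := (1 + ε) ^ n - 1

/-- The preconfigured NOMA receive SNR levels: `P_k = ε (1+ε)^(k-1)`. -/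
noncomputable def snrLevel (ε : ℝ) (k : ℕ) : ℝ := ε * (1 + ε) ^ (k - 1)

/-- The interference budget tolerable to the primary user: `I(x) = P x / ε - 1`. -/
noncomputable def budget (ε P x : ℝ) : ℝ := P * x / ε - 1

/-- The number of supported SNR levels: `0` if `I(x) < η_1`, and otherwise
`max {n ≥ 1 : η_n ≤ I(x)}` (in `ℕ`, `sSup ∅ = 0`). -/
noncomputable def numLevels (ε P x : ℝ) : ℕ :=
  sSup {n : ℕ | 1 ≤ n ∧ eta ε n ≤ budget ε P x}

theorem le_numLevels_iff {ε P x : ℝ} (hε : 0 < ε) {n : ℕ} (hn : 1 ≤ n) :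
    n ≤ numLevels ε P x ↔ eta ε n ≤ budget ε P x := by
  have hbdd : BddAbove {n : ℕ | 1 ≤ n ∧ eta ε n ≤ budget ε P x} := by
    obtain ⟨m, hm⟩ := pow_unbounded_of_one_lt (budget ε P x + 1) (by linarith : 1 < 1 + ε)
    refine ⟨m, fun k hk ↦ ?_⟩
    by_contra! hlt
    have hpow : (1 + ε) ^ m ≤ (1 + ε) ^ k := pow_le_pow_right₀ (by linarith) hlt.le
    have hk' := hk.2
    unfold eta at hk'
    linarith
  refine ⟨fun h ↦ ?_, fun h ↦ le_csSup hbdd ⟨hn, h⟩⟩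
  have hne : {n : ℕ | 1 ≤ n ∧ eta ε n ≤ budget ε P x}.Nonempty := by
    by_contra hempty
    rw [Set.not_nonempty_iff_eq_empty] at hempty
    simp only [numLevels, hempty, csSup_empty, bot_eq_zero] at h
    omega
  have hmax : eta ε (numLevels ε P x) ≤ budget ε P x := (Nat.sSup_mem hne hbdd).2
  have hpow : (1 + ε) ^ n ≤ (1 + ε) ^ numLevels ε P x := pow_le_pow_right₀ (by linarith) h
  unfold eta at hmax ⊢
  linarith

theorem eta_le_budget_iff {ε P x : ℝ} (hε : 0 < ε) (hP : 0 < P) (n : ℕ) :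
    eta ε n ≤ budget ε P x ↔ ε * (1 + ε) ^ n / P ≤ x := by
  rw [eta, budget, sub_le_sub_iff_right, le_div_iff₀ hε, div_le_iff₀ hP, mul_comm ε, mul_comm P]

theorem expMeasure_real_Ici {r t : ℝ} (hr : 0 < r) (ht : 0 ≤ t) :
    (expMeasure r).real (Set.Ici t) = Real.exp (-(r * t)) := by
  have := isProbabilityMeasure_expMeasure hr
  have : NullSingletonClass (expMeasure r) := by
    unfold expMeasure gammaMeasure
    infer_instance
  have hcdf := cdf_expMeasure_eq hr t
  rw [cdf_eq_real, if_pos ht] at hcdf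
  rw [← measureReal_congr Ioi_ae_eq_Ici, ← Set.compl_Iic,
    probReal_compl_eq_one_sub measurableSet_Iic,
    hcdf, sub_sub_cancel]

theorem prob_numLevels_ge (Ω : Type*) [MeasurableSpace Ω] (μ : Measure Ω)
    [IsProbabilityMeasure μ] (R : ℝ) (hR : 0 < R) (ε : ℝ) (hε : ε = 2 ^ R - 1)
    (P : ℝ) (hP : 0 < P) (X : Ω → ℝ) (hX : Measurable X)
    (hdist : μ.map X = expMeasure 1) (n : ℕ) (hn : 1 ≤ n) :
    (μ {ω | n ≤ numLevels ε P (X ω)}).toReal =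
      Real.exp (-(ε * (1 + ε) ^ n) / P) := by
  have hε0 : 0 < ε := by
    have := Real.one_lt_rpow (one_lt_two : (1 : ℝ) < 2) hR
    linarith
  have hset : {ω | n ≤ numLevels ε P (X ω)} = X ⁻¹' Set.Ici (ε * (1 + ε) ^ n / P) := by
    ext ω
    exact (le_numLevels_iff hε0 hn).trans (eta_le_budget_iff hε0 hP n)
  rw [hset, ← Measure.map_apply hX measurableSet_Ici, hdist, ← measureReal_def,
    expMeasure_real_Ici one_pos (by positivity), one_mul, neg_div]
end

section
/- Fix R > 0 and set ε = 2^R − 1. Let X be a standard exponential random variable and let K_P denote the number of supported SNR levels at transmit SNR P. Then for every fixed integer n ≥ 1, lim_{P→∞} P·P(K_P(X) = n) = ε(η_{n+1} − η_n) = ε²(1+ε)^n, and for n = 0, lim_{P→∞} P·P(K_P(X) = 0) = ε² + ε. -/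
open MeasureTheory ProbabilityTheory Real

/-- For `ε > 0`, at most `m` levels are supported iff `x` lies below the threshold
`ε (1+ε)^(m+1) / P`. -/
lemma numLevels_le_iff {ε P : ℝ} (hε : 0 < ε) (hP : 0 < P) (x : ℝ) (m : ℕ) :
    numLevels ε P x ≤ m ↔ x < ε * (1 + ε) ^ (m + 1) / P := by
  have key : ∀ n : ℕ, eta ε n ≤ budget ε P x ↔ ε * (1 + ε) ^ n / P ≤ x := by
    intro n
    rw [eta, budget, sub_le_sub_iff_right, le_div_iff₀ hε, div_le_iff₀ hP, mul_comm ε,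
      mul_comm x]
  have bdd : BddAbove {n : ℕ | 1 ≤ n ∧ eta ε n ≤ budget ε P x} := by
    obtain ⟨N, hN⟩ := pow_unbounded_of_one_lt (budget ε P x + 1) (lt_add_of_pos_right 1 hε)
    refine ⟨N, fun n hn => ?_⟩
    by_contra! h
    have hmono : (1 + ε) ^ N ≤ (1 + ε) ^ n := pow_le_pow_right₀ (by linarith) h.le
    have hn2 := hn.2
    rw [eta] at hn2
    linarith
  rw [← not_le, ← key (m + 1)]
  constructor
  · intro h h'
    have := le_csSup bdd (show m + 1 ∈ _ from ⟨by omega, h'⟩)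
    rw [numLevels] at h
    omega
  · intro h
    refine csSup_le' fun n hn => ?_
    by_contra! hmn
    refine h (le_trans ?_ hn.2)
    have hmono : (1 + ε) ^ (m + 1) ≤ (1 + ε) ^ n := pow_le_pow_right₀ (by linarith) hmn
    rw [eta, eta]
    linarith

/-- The strict distribution function of the standard exponential law on `[0, ∞)`. -/
lemma expMeasure_one_real_Iio {t : ℝ} (ht : 0 ≤ t) :
    (expMeasure 1).real (Set.Iio t) = 1 - exp (-t) := by
  have := isProbabilityMeasure_expMeasure one_pos
  have hac : expMeasure 1 ≪ volume := withDensity_absolutelyContinuous _ _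
  have hae : Set.Iio t =ᵐ[expMeasure 1] Set.Iic t := hac.ae_eq Iio_ae_eq_Iic
  rw [measureReal_congr hae, ← cdf_eq_real, cdf_expMeasure_eq one_pos, if_pos ht, one_mul]

lemma tendsto_mul_one_sub_exp_neg_div (c : ℝ) :
    Filter.Tendsto (fun P : ℝ => P * (1 - exp (-(c / P)))) Filter.atTop (nhds c) := by
  have hd : HasDerivAt (fun h : ℝ => 1 - exp (-(c * h))) c 0 := by
    simpa using (((hasDerivAt_id (0 : ℝ)).const_mul c).neg.exp).const_sub 1
  have hlim := hd.tendsto_slope_zero_right.comp tendsto_inv_atTop_nhdsGT_zero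
  refine hlim.congr fun P => ?_
  simp [div_eq_mul_inv]

/-- If `X` is standard exponential, the scaled probability that at most `m` levels are supported
converges to `ε (1+ε)^(m+1)`. -/
lemma tendsto_scaled_prob_numLevels_le {Ω : Type*} [MeasurableSpace Ω] {μ : Measure Ω}
    {ε : ℝ} (hε : 0 < ε) {X : Ω → ℝ} (hX : Measurable X) (hdist : μ.map X = expMeasure 1)
    (m : ℕ) :
    Filter.Tendsto (fun P : ℝ => P * μ.real {ω | numLevels ε P (X ω) ≤ m})
      Filter.atTop (nhds (ε * (1 + ε) ^ (m + 1))) := by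
  refine (tendsto_mul_one_sub_exp_neg_div _).congr' ?_
  filter_upwards [Filter.eventually_gt_atTop 0] with P hP
  have hset : {ω | numLevels ε P (X ω) ≤ m} = X ⁻¹' Set.Iio (ε * (1 + ε) ^ (m + 1) / P) := by
    ext ω
    exact numLevels_le_iff hε hP (X ω) m
  rw [hset, ← map_measureReal_apply hX measurableSet_Iio, hdist,
    expMeasure_one_real_Iio (by positivity)]

theorem scaled_prob_numLevels_limit (Ω : Type*) [MeasurableSpace Ω] (μ : Measure Ω)
    [IsProbabilityMeasure μ] (R : ℝ) (hR : 0 < R) (ε : ℝ) (hε : ε = 2 ^ R - 1)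
    (X : Ω → ℝ) (hX : Measurable X) (hdist : μ.map X = expMeasure 1) :
    (∀ n : ℕ, 1 ≤ n →
      Filter.Tendsto (fun P : ℝ => P * (μ {ω | numLevels ε P (X ω) = n}).toReal)
        Filter.atTop (nhds (ε * (eta ε (n + 1) - eta ε n))) ∧
      ε * (eta ε (n + 1) - eta ε n) = ε ^ 2 * (1 + ε) ^ n) ∧
    Filter.Tendsto (fun P : ℝ => P * (μ {ω | numLevels ε P (X ω) = 0}).toReal)
      Filter.atTop (nhds (ε ^ 2 + ε)) := by
  have hpos : 0 < ε := by
    rw [hε, sub_pos]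
    exact one_lt_rpow one_lt_two hR
  refine ⟨fun n hn => ⟨?_, by simp only [eta]; ring⟩, ?_⟩
  · obtain ⟨m, rfl⟩ := Nat.exists_eq_add_of_le' hn
    have hlim := (tendsto_scaled_prob_numLevels_le hpos hX hdist (m + 1)).sub
      (tendsto_scaled_prob_numLevels_le hpos hX hdist m)
    have hval : ε * (1 + ε) ^ (m + 1 + 1) - ε * (1 + ε) ^ (m + 1)
        = ε * (eta ε (m + 1 + 1) - eta ε (m + 1)) := by
      simp only [eta]
      ring
    rw [hval] at hlim
    refine hlim.congr' ?_
    filter_upwards [Filter.eventually_gt_atTop 0] with P hP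
    have hmeas : MeasurableSet {ω | numLevels ε P (X ω) ≤ m} := by
      simp only [numLevels_le_iff hpos hP]
      exact measurableSet_lt hX measurable_const
    have hsub : {ω | numLevels ε P (X ω) ≤ m} ⊆ {ω | numLevels ε P (X ω) ≤ m + 1} :=
      fun ω hω => Nat.le_succ_of_le hω
    have hset : {ω | numLevels ε P (X ω) = m + 1}
        = {ω | numLevels ε P (X ω) ≤ m + 1} \ {ω | numLevels ε P (X ω) ≤ m} := by
      ext ω
      simp only [Set.mem_ofPred_eq, Set.mem_sdiff]
      omega
    rw [← mul_sub, ← measureReal_sdiff hsub hmeas, ← hset, measureReal_def]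
  · have hlim := tendsto_scaled_prob_numLevels_le hpos hX hdist 0
    simp only [Nat.le_zero, measureReal_def] at hlim
    convert hlim using 2
    ring
end

section
/- (Lemma 1, part 3) Fix R > 0 and set ε = 2^R − 1. Let X be a standard exponential random variable and let K_P denote the number of supported SNR levels at transmit SNR P. Then the mean number of supported SNR levels is unbounded at high SNR: E[K_P(X)] → ∞ as P → ∞; equivalently, for every real C there exists P₀ such that E[K_P(X)] ≥ C for all P ≥ P₀. -/
open MeasureTheory ProbabilityTheory Real

theorem integrable_id_expMeasure_one : Integrable (fun x : ℝ => x) (expMeasure 1) := by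
  have hpdf : Measurable (gammaPDF 1 1) := (measurable_gammaPDFReal 1 1).ennreal_ofReal
  rw [expMeasure, gammaMeasure,
    integrable_withDensity_iff hpdf (.of_forall fun _ => ENNReal.ofReal_lt_top)]
  have hsupp : Function.support (fun x : ℝ => x * (gammaPDF 1 1 x).toReal) ⊆ Set.Ioi 0 := by
    intro x hx
    by_contra hneg
    rcases (not_lt.mp (Set.mem_Ioi.not.mp hneg)).lt_or_eq with h | h
    · exact hx (by simp [gammaPDF_of_neg h])
    · exact hx (by simp [h])
  rw [← integrableOn_iff_integrable_of_support_subset hsupp]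
  refine (GammaIntegral_convergent (s := 2) two_pos).congr_fun (fun x hx => ?_) measurableSet_Ioi
  have hx0 : (0 : ℝ) ≤ x := le_of_lt hx
  have hexp : (2 : ℝ) - 1 = 1 := by norm_num
  simp [gammaPDF_of_nonneg hx0, hexp, ENNReal.toReal_ofReal (exp_pos _).le, mul_comm]

theorem expMeasure_one_real_Ioi_one : (expMeasure 1).real (Set.Ioi 1) = exp (-1) := by
  have := isProbabilityMeasure_expMeasure one_pos
  have hcdf := cdf_expMeasure_eq one_pos 1
  rw [cdf_eq_real] at hcdf
  rw [← Set.compl_Iic, probReal_compl_eq_one_sub measurableSet_Iic, hcdf]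
  simp

section NumLevels

variable {ε P x : ℝ} {n : ℕ}

/-- Bernoulli's inequality bounds the number of levels fitting into the budget. -/
theorem cast_le_of_eta_le_budget (hε : 0 < ε) (h : eta ε n ≤ budget ε P x) :
    (n : ℝ) ≤ P * x / ε ^ 2 := by
  have hb := one_add_mul_le_pow (show (-2 : ℝ) ≤ ε by linarith) n
  unfold eta budget at h
  have hle : n * ε ≤ P * x / ε := by linarith
  rw [le_div_iff₀ hε] at hle
  rw [le_div_iff₀ (by positivity)]
  linarith

theorem bddAbove_setOf_eta_le_budget (hε : 0 < ε) (P x : ℝ) :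
    BddAbove {n : ℕ | 1 ≤ n ∧ eta ε n ≤ budget ε P x} :=
  ⟨⌊P * x / ε ^ 2⌋₊, fun _ hn => Nat.le_floor (cast_le_of_eta_le_budget hε hn.2)⟩

theorem numLevels_le_abs (hε : 0 < ε) (P x : ℝ) :
    (numLevels ε P x : ℝ) ≤ |P * x / ε ^ 2| := by
  rcases Set.eq_empty_or_nonempty {n : ℕ | 1 ≤ n ∧ eta ε n ≤ budget ε P x} with h | h
  · simp [numLevels, h]
  · exact (cast_le_of_eta_le_budget hε
      (Nat.sSup_mem h (bddAbove_setOf_eta_le_budget hε P x)).2).trans (le_abs_self _)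

theorem le_numLevels (hε : 0 < ε) (hn : 1 ≤ n) (h : eta ε n ≤ budget ε P x) :
    n ≤ numLevels ε P x :=
  le_csSup (bddAbove_setOf_eta_le_budget hε P x) ⟨hn, h⟩

theorem numLevels_mono (hε : 0 < ε) (hP : 0 ≤ P) : Monotone (numLevels ε P) := by
  intro x y hxy
  refine csSup_le_csSup' (bddAbove_setOf_eta_le_budget hε P y) fun n hn => ⟨hn.1, hn.2.trans ?_⟩
  unfold budget
  gcongr

theorem measurable_numLevels (hε : 0 < ε) (hP : 0 ≤ P) :
    Measurable fun x => (numLevels ε P x : ℝ) :=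
  (Nat.mono_cast.comp (numLevels_mono hε hP)).measurable

theorem integrable_numLevels_expMeasure_one (hε : 0 < ε) (hP : 0 ≤ P) :
    Integrable (fun x => (numLevels ε P x : ℝ)) (expMeasure 1) := by
  refine ((integrable_id_expMeasure_one.const_mul P).div_const (ε ^ 2)).mono
    (measurable_numLevels hε hP).aestronglyMeasurable (.of_forall fun x => ?_)
  simpa only [norm_eq_abs, Nat.abs_cast] using numLevels_le_abs hε P x

/-- Once `P` is large enough, every gain above `1` supports at least `n` levels. -/
theorem mul_exp_neg_one_le_integral_numLevels (hε : 0 < ε) (hn : 1 ≤ n)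
    (hP : ε * (1 + ε) ^ n ≤ P) :
    n * exp (-1) ≤ ∫ x, (numLevels ε P x : ℝ) ∂expMeasure 1 := by
  have := isProbabilityMeasure_expMeasure one_pos
  have hP0 : 0 ≤ P := le_trans (by positivity) hP
  have hsub : Set.Ioi (1 : ℝ) ⊆ {x | (n : ℝ) ≤ numLevels ε P x} := by
    intro x hx
    have hx1 : (1 : ℝ) ≤ x := le_of_lt hx
    refine Nat.cast_le (α := ℝ).mpr (le_numLevels hε hn ?_)
    unfold eta budget
    gcongr
    rw [le_div_iff₀ hε]
    nlinarith
  calc n * exp (-1) = n * (expMeasure 1).real (Set.Ioi 1) := by rw [expMeasure_one_real_Ioi_one]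
    _ ≤ n * (expMeasure 1).real {x | (n : ℝ) ≤ numLevels ε P x} :=
      mul_le_mul_of_nonneg_left (measureReal_mono hsub) n.cast_nonneg
    _ ≤ _ := mul_meas_ge_le_integral_of_nonneg (.of_forall fun _ => Nat.cast_nonneg _)
      (integrable_numLevels_expMeasure_one hε hP0) _

end NumLevels

theorem mean_numLevels_unbounded (Ω : Type*) [MeasurableSpace Ω] (μ : Measure Ω)
    [IsProbabilityMeasure μ] (R : ℝ) (hR : 0 < R) (ε : ℝ) (hε : ε = 2 ^ R - 1)
    (X : Ω → ℝ) (hX : Measurable X) (hdist : μ.map X = expMeasure 1) :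
    Filter.Tendsto (fun P : ℝ => ∫ ω, (numLevels ε P (X ω) : ℝ) ∂μ)
      Filter.atTop Filter.atTop := by
  have hε0 : 0 < ε := by
    rw [hε, sub_pos]
    exact one_lt_rpow one_lt_two hR
  refine Filter.tendsto_atTop.mpr fun C => ?_
  obtain ⟨n, hn⟩ := exists_nat_ge (C / exp (-1))
  filter_upwards [Filter.eventually_ge_atTop (ε * (1 + ε) ^ (n + 1))] with P hP
  have hP0 : 0 ≤ P := le_trans (by positivity) hP
  rw [← integral_map (f := fun x => (numLevels ε P x : ℝ)) hX.aemeasurable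
    (measurable_numLevels hε0 hP0).aestronglyMeasurable, hdist]
  refine le_trans ?_ (mul_exp_neg_one_le_integral_numLevels hε0 n.succ_pos hP)
  rw [← div_le_iff₀ (exp_pos _)]
  exact hn.trans (by simp)
end
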